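/- arXiv:math/9610202 — 3 statements merged into one kernel-verified Lean document; each statement's English description precedes it below -/
import Mathlib

section
/- Let $\Omega\subseteq\mathbb{C}^n_\zeta\times\mathbb{C}^n_z\times\mathbb{R}^p_t$ be open and let $\eta=(\eta_1,\dots,\eta_n):\Omega\to\mathbb{C}^n$ be a $C^\infty$ map satisfying $\sum_{k=1}^n \eta_k(\zeta,z,t)\,(\zeta_k-z_k)=1$ for all $(\zeta,z,t)\in\Omega$. Then the exterior differential of the $(n-1)$-form $\omega'(\eta)$ satisfies $d\,\omega'(\eta)\wedge\omega(\zeta)\wedge\omega(z)=0$ on $\Omega$. -/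
/-- The wedge product of an `a`-form and a `b`-form (given pointwise as bare functions on
tuples of vectors), via the permutation-sum formula with the `1/(a! b!)` normalization. -/
noncomputable def wedgeEval {E : Type*} [AddCommGroup E] [Module ℝ E] (a b : ℕ)
    (α : (Fin a → E) → ℂ) (β : (Fin b → E) → ℂ) : (Fin (a + b) → E) → ℂ :=
  fun v => ((a.factorial * b.factorial : ℕ) : ℂ)⁻¹ *
    ∑ σ : Equiv.Perm (Fin (a + b)), ((Equiv.Perm.sign σ : ℤ) : ℂ) *
      (α fun i => v (σ (Fin.castAdd b i))) * (β fun j => v (σ (Fin.natAdd a j)))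

/-- The exterior differential of an `a`-form field on a real normed space, via the standard
formula `dα(v₀,…,vₐ) = ∑ᵢ (-1)ⁱ D_{vᵢ}(α(·)(v₀,…,v̂ᵢ,…,vₐ))`. -/
noncomputable def extDer {E : Type*} [NormedAddCommGroup E] [NormedSpace ℝ E] (a : ℕ)
    (α : E → (Fin a → E) → ℂ) : E → (Fin (a + 1) → E) → ℂ :=
  fun x v => ∑ i : Fin (a + 1),
    (-1 : ℂ) ^ (i : ℕ) * fderiv ℝ (fun y => α y fun j => v (i.succAbove j)) x (v i)

/-- The Cauchy–Fantappiè form `ω'(η) = ∑ₖ (-1)^(k-1) ηₖ dη₁∧⋯∧d̂ηₖ∧⋯∧dηₙ` of an `n`-tuple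
of functions (here `n = N+1`, zero-based indexing). -/
noncomputable def omegaPrime {E : Type*} [NormedAddCommGroup E] [NormedSpace ℝ E] (N : ℕ)
    (η : Fin (N + 1) → E → ℂ) : E → (Fin N → E) → ℂ :=
  fun x w => ∑ k : Fin (N + 1), (-1 : ℂ) ^ (k : ℕ) * η k x *
    Matrix.det (Matrix.of fun i j : Fin N => fderiv ℝ (η (k.succAbove i)) x (w j))

open Equiv in
theorem laplace_perm (a b : ℕ) (M : Matrix (Fin (a+b)) (Fin (a+b)) ℂ) :
    ∑ σ : Equiv.Perm (Fin (a + b)), ((Equiv.Perm.sign σ : ℤ) : ℂ) *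
      Matrix.det (Matrix.of fun i j : Fin a => M (Fin.castAdd b i) (σ (Fin.castAdd b j))) *
      Matrix.det (Matrix.of fun i j : Fin b => M (Fin.natAdd a i) (σ (Fin.natAdd a j)))
      = (Fintype.card (Perm (Fin a)) * Fintype.card (Perm (Fin b)) : ℂ) * M.det := by
  have key : ∀ (τ₁ : Perm (Fin a)) (τ₂ : Perm (Fin b)),
      ∑ σ : Equiv.Perm (Fin (a + b)), ((Equiv.Perm.sign σ : ℤ) : ℂ) *
        (((Perm.sign τ₁ : ℤ) : ℂ) * ∏ i, M (Fin.castAdd b i) (σ (Fin.castAdd b (τ₁ i)))) *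
        (((Perm.sign τ₂ : ℤ) : ℂ) * ∏ i, M (Fin.natAdd a i) (σ (Fin.natAdd a (τ₂ i)))) = M.det := by
    intro τ₁ τ₂
    rw [← Matrix.det_transpose, Matrix.det_apply']
    refine Fintype.sum_equiv (Equiv.mulRight (finSumFinEquiv.permCongr (Perm.sumCongr τ₁ τ₂))) _ _ ?_
    intro σ
    simp only [Equiv.coe_mulRight, Perm.sign_mul, Perm.sign_permCongr, Perm.sign_sumCongr,
      Fin.prod_univ_add, Matrix.transpose_apply, Perm.mul_apply, Equiv.permCongr_apply,
      finSumFinEquiv_symm_apply_castAdd, finSumFinEquiv_symm_apply_natAdd,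
      Perm.sumCongr_apply, Sum.map_inl, Sum.map_inr, finSumFinEquiv_apply_left,
      finSumFinEquiv_apply_right]
    push_cast
    ring
  have e : ∀ (m : ℕ) (A : Matrix (Fin m) (Fin m) ℂ), A.det = ∑ τ : Perm (Fin m),
      ((Perm.sign τ : ℤ) : ℂ) * ∏ i, A i (τ i) := by
    intro m A
    rw [← Matrix.det_transpose, Matrix.det_apply']; rfl
  simp only [e a, e b, Matrix.of_apply]
  simp only [Finset.mul_sum, Finset.sum_mul]
  rw [Finset.sum_comm]
  simp_rw [Finset.sum_comm (s := (Finset.univ : Finset (Perm (Fin (a+b)))))]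
  simp only [key]
  simp [mul_assoc, mul_left_comm]

theorem fderiv_det_apply {E : Type*} [NormedAddCommGroup E] [NormedSpace ℝ E] (N : ℕ)
    (A : E → Matrix (Fin N) (Fin N) ℂ) (x u : E)
    (hA : ∀ i j, DifferentiableAt ℝ (fun y => A y i j) x) :
    DifferentiableAt ℝ (fun y => (A y).det) x ∧
    fderiv ℝ (fun y => (A y).det) x u =
      ∑ a, ((A x).updateRow a (fun j => fderiv ℝ (fun y => A y a j) x u)).det := by
  have e : ∀ (A : Matrix (Fin N) (Fin N) ℂ), A.det = ∑ τ : Equiv.Perm (Fin N),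
      ((Equiv.Perm.sign τ : ℤ) : ℂ) * ∏ i, A i (τ i) := by
    intro A
    rw [← Matrix.det_transpose, Matrix.det_apply']; rfl
  have hp : ∀ τ : Equiv.Perm (Fin N), HasFDerivAt (fun y => ∏ i, A y i (τ i))
      (∑ i, (∏ j ∈ Finset.univ.erase i, A x j (τ j)) • fderiv ℝ (fun y => A y i (τ i)) x) x := by
    intro τ
    exact HasFDerivAt.finsetProd (fun i _ => (hA i (τ i)).hasFDerivAt)
  have hs : HasFDerivAt (fun y => (A y).det) (∑ τ : Equiv.Perm (Fin N),
      ((Equiv.Perm.sign τ : ℤ) : ℂ) • (∑ i, (∏ j ∈ Finset.univ.erase i, A x j (τ j)) • fderiv ℝ (fun y => A y i (τ i)) x)) x := by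
    simp only [e]
    exact HasFDerivAt.fun_sum fun τ _ => (hp τ).const_mul _
  refine ⟨hs.differentiableAt, ?_⟩
  rw [hs.fderiv]
  simp only [e, sum_apply, smul_apply, smul_eq_mul, Finset.mul_sum]
  rw [Finset.sum_comm]
  refine Finset.sum_congr rfl fun a _ => Finset.sum_congr rfl fun τ _ => ?_
  rw [← Finset.mul_prod_erase Finset.univ _ (Finset.mem_univ a)]
  rw [Matrix.updateRow_self, mul_comm (∏ j ∈ _, _)]
  congr 2
  refine Finset.prod_congr rfl fun j hj => ?_
  rw [Matrix.updateRow_ne (Finset.ne_of_mem_erase hj)]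

theorem det_update_aux {E : Type*} [AddCommGroup E] [Module ℝ E] {M : ℕ}
    (L : Fin M → E →ₗ[ℝ] ℂ) (w : Fin M → E) (j : Fin M) (z : E) :
    (Matrix.of fun i k => L i (Function.update w j z k)).det =
      ((Matrix.of fun i k => L i (w k)).updateCol j (fun i => L i z)).det := by
  congr 1
  ext i k
  by_cases hk : k = j
  · subst hk; simp
  · simp [hk]

/-- alternating determinant form -/
noncomputable def detForm {E : Type*} [AddCommGroup E] [Module ℝ E] (M : ℕ)
    (L : Fin M → E →ₗ[ℝ] ℂ) : E [⋀^Fin M]→ₗ[ℝ] ℂ where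
  toFun w := Matrix.det (Matrix.of fun i j => L i (w j))
  map_update_add' := by
    intro inst w j u u'
    obtain rfl := Subsingleton.elim inst (instDecidableEqFin M)
    rw [det_update_aux, det_update_aux, det_update_aux, ← Matrix.det_updateCol_add]
    congr 2; ext i; simp
  map_update_smul' := by
    intro inst w j c u
    obtain rfl := Subsingleton.elim inst (instDecidableEqFin M)
    rw [det_update_aux, det_update_aux, Complex.real_smul, ← Matrix.det_updateCol_smul]
    congr 2; ext i; simp
  map_eq_zero_of_eq' := by
    intro w i j h hij
    exact Matrix.det_zero_of_column_eq hij (fun k => by simp [h])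

theorem closed_aux {E : Type*} [AddCommGroup E] [Module ℝ E] (M : ℕ)
    (L : Fin (M+1) → E →ₗ[ℝ] ℂ) (a : Fin (M+1)) (H : E →ₗ[ℝ] E →ₗ[ℝ] ℂ)
    (hH : ∀ u w, H u w = H w u) (v : Fin (M+2) → E) :
    ∑ i : Fin (M+2), (-1 : ℂ) ^ (i : ℕ) *
      ((Matrix.of fun p q : Fin (M+1) => L p (v (i.succAbove q))).updateRow a
        (fun q => H (v i) (v (i.succAbove q)))).det = 0 := by
  let D : E [⋀^Fin M]→ₗ[ℝ] ℂ := detForm M (fun p => L (a.succAbove p))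
  let f : E →ₗ[ℝ] E →ₗ[ℝ] E [⋀^Fin M]→ₗ[ℝ] ℂ :=
    LinearMap.mk₂ ℝ (fun u w => H u w • D)
      (by intros; simp [add_smul]) (by intros; simp [mul_smul])
      (by intros; simp [add_smul]) (by intros; simp [mul_smul])
  have hf : ∀ u w, f u w = f w u := by
    intro u w; simp [f, hH u w]
  have h0 := congrArg (fun F => (-1 : ℂ) ^ (a : ℕ) * F v)
    (AlternatingMap.alternatizeUncurryFin_alternatizeUncurryFinLM_comp_of_symmetric hf)
  simp only [AlternatingMap.alternatizeUncurryFin_apply, LinearMap.comp_apply,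
    AlternatingMap.alternatizeUncurryFinLM_apply, AlternatingMap.zero_apply, mul_zero] at h0
  rw [← h0, Finset.mul_sum]
  refine Finset.sum_congr rfl fun i _ => ?_
  rw [Matrix.det_succ_row _ a]
  simp only [Finset.mul_sum, zsmul_eq_mul, f, LinearMap.mk₂_apply, AlternatingMap.smul_apply,
    smul_eq_mul]
  refine Finset.sum_congr rfl fun q _ => ?_
  have : (((Matrix.of fun p q : Fin (M+1) => L p (v (i.succAbove q))).updateRow a
        (fun q => H (v i) (v (i.succAbove q)))).submatrix a.succAbove q.succAbove).det
      = D (q.removeNth (i.removeNth v)) := by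
    change _ = Matrix.det _
    congr 1
    ext p r
    simp [Matrix.updateRow_ne, Fin.removeNth]
  rw [this, Matrix.updateRow_self]
  simp only [Fin.removeNth]
  push_cast
  ring

theorem extDer_omegaPrime {E : Type*} [NormedAddCommGroup E] [NormedSpace ℝ E] (N : ℕ)
    (η : Fin (N + 1) → E → ℂ) (x : E) (hη : ∀ k, ContDiffAt ℝ 2 (η k) x) (v : Fin (N+1) → E) :
    extDer N (omegaPrime N η) x v =
      (N + 1 : ℂ) * Matrix.det (Matrix.of fun i j => fderiv ℝ (η i) x (v j)) := by
  have hd : ∀ k, DifferentiableAt ℝ (η k) x := fun k => (hη k).differentiableAt (by norm_num)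
  have hd2 : ∀ k, DifferentiableAt ℝ (fderiv ℝ (η k)) x := fun k =>
    ((hη k).fderiv_right (m := 1) (by norm_num)).differentiableAt (by norm_num)
  have hsymm : ∀ k u w, fderiv ℝ (fderiv ℝ (η k)) x u w = fderiv ℝ (fderiv ℝ (η k)) x w u :=
    fun k u w => ((hη k).isSymmSndFDerivAt (by simp)).eq u w
  have hent : ∀ k w u, fderiv ℝ (fun y => fderiv ℝ (η k) y w) x u =
      fderiv ℝ (fderiv ℝ (η k)) x u w := by
    intro k w u
    have := ((hd2 k).hasFDerivAt.clm_apply (hasFDerivAt_const w x)).fderiv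
    rw [this]; simp
  -- derivative of each term
  have hder : ∀ i : Fin (N+1), fderiv ℝ (fun y => omegaPrime N η y fun j => v (i.succAbove j)) x (v i)
      = ∑ k : Fin (N+1), (-1 : ℂ) ^ (k : ℕ) *
        (η k x * ∑ a, ((Matrix.of fun p q : Fin N =>
            fderiv ℝ (η (k.succAbove p)) x (v (i.succAbove q))).updateRow a
            (fun q => fderiv ℝ (fderiv ℝ (η (k.succAbove a))) x (v i) (v (i.succAbove q)))).det
        + fderiv ℝ (η k) x (v i) * Matrix.det (Matrix.of fun p q : Fin N =>
            fderiv ℝ (η (k.succAbove p)) x (v (i.succAbove q)))) := by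
    intro i
    have hD := fun k : Fin (N+1) => fderiv_det_apply N (fun y => Matrix.of fun p q : Fin N =>
            fderiv ℝ (η (k.succAbove p)) y (v (i.succAbove q))) x (v i)
            (fun p q => (hd2 _).clm_apply (differentiableAt_const _))
    have : HasFDerivAt (fun y => omegaPrime N η y fun j => v (i.succAbove j))
      (∑ k : Fin (N+1), (-1 : ℂ) ^ (k : ℕ) • (η k x • fderiv ℝ (fun y => (Matrix.of fun p q : Fin N =>
            fderiv ℝ (η (k.succAbove p)) y (v (i.succAbove q))).det) x +
            (Matrix.of fun p q : Fin N =>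
            fderiv ℝ (η (k.succAbove p)) x (v (i.succAbove q))).det • fderiv ℝ (η k) x)) x := by
      simp only [omegaPrime, mul_assoc]
      exact HasFDerivAt.fun_sum fun k _ =>
        ((hd k).hasFDerivAt.mul (hD k).1.hasFDerivAt).const_mul _
    rw [this.fderiv]
    simp only [sum_apply, smul_apply, add_apply, smul_eq_mul, (hD _).2, Matrix.of_apply, hent]
    refine Finset.sum_congr rfl fun k _ => ?_
    ring
  simp only [extDer, hder]
  have h1 : ∀ k : Fin (N+1), ∑ i : Fin (N+1), (-1 : ℂ) ^ (i : ℕ) *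
      ∑ a, ((Matrix.of fun p q : Fin N =>
            fderiv ℝ (η (k.succAbove p)) x (v (i.succAbove q))).updateRow a
            (fun q => fderiv ℝ (fderiv ℝ (η (k.succAbove a))) x (v i) (v (i.succAbove q)))).det = 0 := by
    intro k
    simp only [Finset.mul_sum]
    rw [Finset.sum_comm]
    refine Finset.sum_eq_zero fun a _ => ?_
    cases N with
    | zero => exact a.elim0
    | succ M =>
      exact closed_aux M (fun p => (fderiv ℝ (η (k.succAbove p)) x).toLinearMap) a
        (LinearMap.mk₂ ℝ (fun u w => fderiv ℝ (fderiv ℝ (η (k.succAbove a))) x u w)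
          (by intros; simp) (by intros; simp) (by intros; simp) (by intros; simp))
        (fun u w => hsymm _ u w) v
  have h2 : ∀ i : Fin (N+1), Matrix.det (Matrix.of fun i j => fderiv ℝ (η i) x (v j)) =
      ∑ k : Fin (N+1), (-1 : ℂ) ^ (i : ℕ) * ((-1 : ℂ) ^ (k : ℕ) * (fderiv ℝ (η k) x (v i) *
        Matrix.det (Matrix.of fun p q : Fin N =>
            fderiv ℝ (η (k.succAbove p)) x (v (i.succAbove q))))) := by
    intro i
    rw [Matrix.det_succ_column _ i]
    refine Finset.sum_congr rfl fun k _ => ?_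
    rw [pow_add, Matrix.of_apply]
    have : ((Matrix.of fun i j => fderiv ℝ (η i) x (v j)).submatrix k.succAbove i.succAbove) =
      Matrix.of fun p q : Fin N => fderiv ℝ (η (k.succAbove p)) x (v (i.succAbove q)) := rfl
    rw [this]; ring
  simp only [mul_add, Finset.sum_add_distrib, Finset.mul_sum (Finset.univ : Finset (Fin (N+1)))]
  simp only [← h2]
  rw [Finset.sum_comm]
  have h3 : ∀ k : Fin (N+1), ∑ i : Fin (N+1), (-1 : ℂ) ^ (i : ℕ) * ((-1 : ℂ) ^ (k : ℕ) * (η k x *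
      ∑ a, ((Matrix.of fun p q : Fin N =>
            fderiv ℝ (η (k.succAbove p)) x (v (i.succAbove q))).updateRow a
            (fun q => fderiv ℝ (fderiv ℝ (η (k.succAbove a))) x (v i) (v (i.succAbove q)))).det)) = 0 := by
    intro k
    rw [← mul_zero ((-1 : ℂ) ^ (k : ℕ) * η k x), ← h1 k, Finset.mul_sum]
    exact Finset.sum_congr rfl fun i _ => by ring
  simp only [h3]
  simp

/-- If `η = (η₁,…,ηₙ)` is smooth on an open `Ω ⊆ ℂⁿ_ζ × ℂⁿ_z × ℝᵖ_t` and satisfies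
`∑ₖ ηₖ(ζ,z,t)(ζₖ - zₖ) = 1` on `Ω`, then `dω'(η) ∧ ω(ζ) ∧ ω(z) = 0` on `Ω`
(here `n = N+1`, and `ω(ζ) ∧ ω(z)` is the wedge of the coordinate differentials
`dζ₁∧⋯∧dζₙ∧dz₁∧⋯∧dzₙ`). -/
theorem d_omegaPrime_wedge_eq_zero (N p : ℕ)
    (Ω : Set ((Fin (N + 1) → ℂ) × (Fin (N + 1) → ℂ) × (Fin p → ℝ))) (hΩ : IsOpen Ω)
    (η : Fin (N + 1) → (Fin (N + 1) → ℂ) × (Fin (N + 1) → ℂ) × (Fin p → ℝ) → ℂ)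
    (hη : ∀ k, ContDiffOn ℝ (⊤ : ℕ∞) (η k) Ω)
    (hleray : ∀ x ∈ Ω, ∑ k, η k x * (x.1 k - x.2.1 k) = 1) :
    ∀ x ∈ Ω,
      ∀ v : Fin (N + 1 + (N + 1 + (N + 1))) →
          (Fin (N + 1) → ℂ) × (Fin (N + 1) → ℂ) × (Fin p → ℝ),
        wedgeEval (N + 1) (N + 1 + (N + 1)) (extDer N (omegaPrime N η) x)
          (fun u => Matrix.det (Matrix.of fun i j : Fin (N + 1 + (N + 1)) =>
            Fin.addCases (fun a : Fin (N + 1) => (u j).1 a)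
              (fun b : Fin (N + 1) => (u j).2.1 b) i))
          v = 0 := by
  intro x hx v
  have hCD : ∀ k, ContDiffAt ℝ (⊤ : ℕ∞) (η k) x := fun k => (hη k).contDiffAt (hΩ.mem_nhds hx)
  have h2 : ∀ k, ContDiffAt ℝ 2 (η k) x := fun k => (hCD k).of_le (WithTop.coe_le_coe.2 (le_top : (2 : ℕ∞) ≤ ⊤))
  have hd : ∀ k, HasFDerivAt (η k) (fderiv ℝ (η k) x) x := fun k =>
    ((h2 k).differentiableAt (by norm_num)).hasFDerivAt
  -- differentiated Leray relation
  have hrel : ∀ w : (Fin (N + 1) → ℂ) × (Fin (N + 1) → ℂ) × (Fin p → ℝ),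
      ∑ k, (η k x * (w.1 k - w.2.1 k) + (x.1 k - x.2.1 k) * fderiv ℝ (η k) x w) = 0 := by
    intro w
    let l : Fin (N+1) → ((Fin (N + 1) → ℂ) × (Fin (N + 1) → ℂ) × (Fin p → ℝ)) →L[ℝ] ℂ := fun k =>
      (ContinuousLinearMap.proj k).comp (ContinuousLinearMap.fst ℝ _ _) -
      (ContinuousLinearMap.proj k).comp
        ((ContinuousLinearMap.fst ℝ _ _).comp (ContinuousLinearMap.snd ℝ _ _))
    have hs : HasFDerivAt (fun y => ∑ k, η k y * l k y)
        (∑ k, (η k x • l k + l k x • fderiv ℝ (η k) x)) x :=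
      HasFDerivAt.fun_sum fun k _ => (hd k).mul (l k).hasFDerivAt
    have hc : HasFDerivAt (fun y => ∑ k, η k y * l k y)
        (0 : ((Fin (N + 1) → ℂ) × (Fin (N + 1) → ℂ) × (Fin p → ℝ)) →L[ℝ] ℂ) x := by
      refine (hasFDerivAt_const (1 : ℂ) x).congr_of_eventuallyEq ?_
      filter_upwards [hΩ.mem_nhds hx] with y hy
      exact hleray y hy
    have := congrArg (fun F => F w) (hs.unique hc)
    simpa [l, sum_apply] using this
  let M : Matrix (Fin (N + 1 + (N + 1 + (N + 1)))) (Fin (N + 1 + (N + 1 + (N + 1)))) ℂ :=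
    Matrix.of fun i j => Fin.addCases (fun a => fderiv ℝ (η a) x (v j))
      (fun b => Fin.addCases (fun a : Fin (N + 1) => (v j).1 a)
              (fun b : Fin (N + 1) => (v j).2.1 b) b) i
  have hM : M.det = 0 := by
    rw [← Matrix.exists_vecMul_eq_zero_iff]
    refine ⟨fun i => Fin.addCases (fun a => x.1 a - x.2.1 a)
      (fun b => Fin.addCases (fun a : Fin (N + 1) => η a x) (fun a => - η a x) b) i, ?_, ?_⟩
    · intro h
      have h1 := hleray x hx
      rw [Finset.sum_eq_zero] at h1
      · exact zero_ne_one h1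
      · intro k _
        have := congrFun h (Fin.castAdd _ k)
        simp only [Fin.addCases_left, Pi.zero_apply] at this
        rw [this, mul_zero]
    · ext j
      rw [Pi.zero_apply, ← hrel (v j)]
      simp only [Matrix.vecMul, dotProduct]
      rw [Fin.sum_univ_add, Fin.sum_univ_add (a := N + 1) (b := N + 1)]
      simp only [M, Matrix.of_apply,
        Fin.addCases_left, Fin.addCases_right, ← Finset.sum_add_distrib]
      exact Finset.sum_congr rfl fun k _ => by ring
  have hL := laplace_perm (N+1) (N+1+(N+1)) M
  rw [hM, mul_zero] at hL
  simp only [M, Matrix.of_apply, Fin.addCases_left, Fin.addCases_right] at hL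
  simp only [wedgeEval, extDer_omegaPrime N η x h2]
  rw [mul_eq_zero]
  right
  rw [← mul_zero (N + 1 : ℂ), ← hL, Finset.mul_sum]
  exact Finset.sum_congr rfl fun σ _ => by ring
end

section
/- Let $\mathbf{M}=\{z\in\mathbf{B}^n:\rho_1(z)=\cdots=\rho_m(z)=0\}$ be a generic CR submanifold of the unit ball $\mathbf{B}^n\subset\mathbb{C}^n$, where $\rho_1,\dots,\rho_m$ ($m<n$) are real-valued $C^\infty$ functions with $\partial\rho_1\wedge\cdots\wedge\partial\rho_m\neq 0$ on $\mathbf{M}$. Then for every point $\zeta_0\in\mathbf{M}$ there exists a neighborhood $\mathbf{V}_\epsilon(\zeta_0)=\{\zeta:|\zeta-\zeta_0|<\epsilon\}$ such that for all integers $s,p$ with $n\ge s>n-m$ and $p>2n-s-m$, and all index tuples $i_1<\cdots<i_p$ and $k_1<\cdots<k_s$, there exist $C^\infty$ differential forms $g_{j_1\dots j_t}^{i_1\dots i_p}$ on $\mathbf{V}_\epsilon$ (with $t=p-(2n-s-m)$) such that on $\mathbf{V}_\epsilon$: $d\bar\zeta_{i_1}\wedge\cdots\wedge d\bar\zeta_{i_p}\wedge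 d\zeta_{k_1}\wedge\cdots\wedge d\zeta_{k_s}=\sum d\rho_{j_1}\wedge\cdots\wedge d\rho_{j_t}\wedge g_{j_1\dots j_t}^{i_1\dots i_p}(\zeta)$, the sum running over tuples $j_1<\cdots<j_t$ from $\{1,\dots,m\}$. -/
lemma alt_sum_apply {E : Type*} [AddCommGroup E] [Module ℝ E] {q : ℕ} {ι : Type*}
    (S : Finset ι) (β : ι → AlternatingMap ℝ E ℂ (Fin q)) (v : Fin q → E) :
    (∑ x ∈ S, β x) v = ∑ x ∈ S, β x v := by
  classical
  induction S using Finset.induction_on with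
  | empty => simp
  | insert x S hx ih => simp [Finset.sum_insert hx, ih]

/-- determinant form of a family of real covectors -/
noncomputable def Dform {E : Type*} [AddCommGroup E] [Module ℝ E] {b : ℕ}
    (μ : Fin b → E →ₗ[ℝ] ℝ) : AlternatingMap ℝ E ℂ (Fin b) :=
  Complex.ofRealCLM.toLinearMap.compAlternatingMap
    ((Matrix.detRowAlternating (n := Fin b) (R := ℝ)).compLinearMap (LinearMap.pi μ))

lemma Dform_apply {E : Type*} [AddCommGroup E] [Module ℝ E] {b : ℕ}
    (μ : Fin b → E →ₗ[ℝ] ℝ) (v : Fin b → E) :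
    Dform μ v = Matrix.det (Matrix.of fun i j => ((μ i (v j) : ℝ) : ℂ)) := by
  have : Dform μ v = ((Matrix.det (Matrix.of fun i j => μ j (v i)) : ℝ) : ℂ) := rfl
  rw [this, ← Matrix.det_transpose]
  exact RingHom.map_det Complex.ofRealHom _

lemma wedge_det {E : Type*} [AddCommGroup E] [Module ℝ E] {a b : ℕ}
    (μ : Fin (a + b) → E →ₗ[ℝ] ℝ) (v : Fin (a + b) → E) :
    wedgeEval a b (fun u => Dform (fun i => μ (Fin.castAdd b i)) u)
      (fun u => Dform (fun i => μ (Fin.natAdd a i)) u) v = Dform μ v := by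
  set F : Fin (a + b) → Fin (a + b) → ℂ := fun i j => ((μ i (v j) : ℝ) : ℂ) with hF
  have key : ∀ (τ₁ : Equiv.Perm (Fin a)) (τ₂ : Equiv.Perm (Fin b)),
      ∑ σ : Equiv.Perm (Fin (a + b)), ((Equiv.Perm.sign σ : ℤ) : ℂ) *
        ((((Equiv.Perm.sign τ₁ : ℤ) : ℂ) * ∏ i, F (Fin.castAdd b i) (σ (Fin.castAdd b (τ₁ i)))) *
        (((Equiv.Perm.sign τ₂ : ℤ) : ℂ) * ∏ i, F (Fin.natAdd a i) (σ (Fin.natAdd a (τ₂ i)))))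
      = Dform μ v := by
    intro τ₁ τ₂
    let τ : Equiv.Perm (Fin (a + b)) := finSumFinEquiv.permCongr (Equiv.Perm.sumCongr τ₁ τ₂)
    have hs : (Equiv.Perm.sign τ : ℤ) = Equiv.Perm.sign τ₁ * Equiv.Perm.sign τ₂ := by
      simp [τ, Equiv.Perm.sign_permCongr, Equiv.Perm.sign_sumCongr]
    rw [Dform_apply, ← Matrix.det_transpose, Matrix.det_apply']
    refine Eq.trans ?_ (Equiv.sum_comp (Equiv.mulRight τ) _)
    refine Finset.sum_congr rfl fun σ _ => ?_
    rw [Fin.prod_univ_add]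
    have h1 : ∀ i, τ (Fin.castAdd b i) = Fin.castAdd b (τ₁ i) := by
      intro i; simp [τ, Equiv.permCongr_apply]
    have h2 : ∀ i, τ (Fin.natAdd a i) = Fin.natAdd a (τ₂ i) := by
      intro i; simp [τ, Equiv.permCongr_apply]
    simp only [Equiv.coe_mulRight, Equiv.Perm.sign_mul, Equiv.Perm.mul_apply, h1, h2,
      Matrix.transpose_apply, Matrix.of_apply, Units.val_mul, hs, Int.cast_mul, hF]
    ring
  have hne : ((a.factorial * b.factorial : ℕ) : ℂ) ≠ 0 := by
    exact_mod_cast (Nat.mul_pos a.factorial_pos b.factorial_pos).ne'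
  unfold wedgeEval
  rw [inv_mul_eq_iff_eq_mul₀ hne]
  have : ((a.factorial * b.factorial : ℕ) : ℂ) * Dform μ v =
      ∑ τ₁ : Equiv.Perm (Fin a), ∑ τ₂ : Equiv.Perm (Fin b), Dform μ v := by
    simp [Fintype.card_perm, mul_assoc]
  rw [this, Finset.sum_congr rfl fun τ₁ _ => Finset.sum_congr rfl fun τ₂ _ => (key τ₁ τ₂).symm]
  conv_rhs => enter [2, τ₁]; rw [Finset.sum_comm]
  rw [Finset.sum_comm]
  refine Finset.sum_congr rfl fun σ _ => ?_
  beta_reduce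
  rw [mul_assoc, Dform_apply, Dform_apply,
    ← Matrix.det_transpose (Matrix.of fun (i j : Fin a) => _), Matrix.det_apply',
    ← Matrix.det_transpose (Matrix.of fun (i j : Fin b) => _), Matrix.det_apply',
    Finset.sum_mul_sum, Finset.mul_sum]
  refine Finset.sum_congr rfl fun τ₁ _ => ?_
  rw [Finset.mul_sum]
  rfl

open Classical in
lemma expansion {E : Type*} [AddCommGroup E] [Module ℝ E] {N q : ℕ}
    (B : Module.Basis (Fin N) ℝ E) (ω : AlternatingMap ℝ E ℂ (Fin q)) :
    ω = ∑ f : Fin q → Fin N, if StrictMono f then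
      (ω fun i => B (f i)) • Dform (fun i => B.coord (f i)) else 0 := by
  set Φ := ∑ f : Fin q → Fin N, if StrictMono f then
      (ω fun i => B (f i)) • Dform (fun i => B.coord (f i)) else 0 with hΦ
  have strict : ∀ h : Fin q → Fin N, StrictMono h → ω (fun i => B (h i)) = Φ fun i => B (h i) := by
    intro h hh
    rw [hΦ, alt_sum_apply, Finset.sum_eq_single h]
    · rw [if_pos hh, AlternatingMap.smul_apply, Dform_apply]
      have : (Matrix.of fun i j => ((B.coord (h i) (B (h j)) : ℝ) : ℂ)) = 1 := by
        ext i j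
        by_cases hij : i = j
        · subst hij; simp
        · have : h j ≠ h i := fun hc => hij (hh.injective hc.symm)
          simp [hij, Finsupp.single_apply, this]
      rw [this]; simp
    · intro f _ hf
      split_ifs with hfs
      · rw [AlternatingMap.smul_apply, Dform_apply]
        have : ∃ i, f i ∉ Set.range h := by
          by_contra! hc
          apply hf
          have hsub : Finset.univ.image f ⊆ Finset.univ.image h := by
            intro x hx
            simp only [Finset.mem_image, Finset.mem_univ, true_and] at hx ⊢
            obtain ⟨i, rfl⟩ := hx
            exact hc i
          have heq := Finset.eq_of_subset_of_card_le hsub (by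
            rw [Finset.card_image_of_injective _ hfs.injective,
              Finset.card_image_of_injective _ hh.injective])
          refine (StrictMono.range_inj hfs hh).1 ?_
          have := congrArg (fun s : Finset (Fin N) => (s : Set (Fin N))) heq
          simpa using this
        obtain ⟨i, hi⟩ := this
        rw [Matrix.det_eq_zero_of_row_eq_zero i]
        · simp
        · intro j
          have : h j ≠ f i := fun hc => hi ⟨j, hc⟩
          simp [Finsupp.single_apply, this]
      · rfl
    · simp
  refine Module.Basis.ext_alternating B ?_
  intro h hinj
  let σ := Tuple.sort h
  have hm : StrictMono (h ∘ σ) :=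
    (Tuple.monotone_sort h).strictMono_of_injective (hinj.comp σ.injective)
  have := strict _ hm
  have e1 := ω.map_perm (fun i => B (h i)) σ
  have e2 := Φ.map_perm (fun i => B (h i)) σ
  have : Equiv.Perm.sign σ • ω (fun i => B (h i)) = Equiv.Perm.sign σ • Φ (fun i => B (h i)) := by
    rw [← e1, ← e2]; exact this
  exact smul_left_cancel _ this

open Classical in
/-- the coefficient forms -/
noncomputable def Gform {E : Type*} [AddCommGroup E] [Module ℝ E] {N m a b : ℕ}
    (hN : m ≤ N) (e : Fin N → E) (μ : Fin N → E →ₗ[ℝ] ℝ) (ω : AlternatingMap ℝ E ℂ (Fin (a + b)))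
    (c : Fin a → Fin m) : AlternatingMap ℝ E ℂ (Fin b) :=
  ∑ f : Fin (a + b) → Fin N,
    if StrictMono f ∧ (∀ i, f (Fin.castAdd b i) = Fin.castLE hN (c i)) then
      (ω fun i => e (f i)) • Dform (fun i => μ (f (Fin.natAdd a i))) else 0

lemma wedge_sum {E : Type*} [AddCommGroup E] [Module ℝ E] {a b : ℕ} {ι : Type*} [Fintype ι]
    (α : (Fin a → E) → ℂ) (β : ι → AlternatingMap ℝ E ℂ (Fin b)) (v : Fin (a + b) → E) :
    wedgeEval a b α (fun u => (∑ x, β x) u) v = ∑ x, wedgeEval a b α (fun u => β x u) v := by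
  unfold wedgeEval
  rw [← Finset.mul_sum, Finset.sum_comm]
  simp only [alt_sum_apply, Finset.mul_sum]

lemma wedge_smul {E : Type*} [AddCommGroup E] [Module ℝ E] {a b : ℕ}
    (α : (Fin a → E) → ℂ) (z : ℂ) (β : AlternatingMap ℝ E ℂ (Fin b)) (v : Fin (a + b) → E) :
    wedgeEval a b α (fun u => (z • β) u) v = z * wedgeEval a b α (fun u => β u) v := by
  unfold wedgeEval
  rw [mul_left_comm, Finset.mul_sum (a := z)]
  congr 1
  refine Finset.sum_congr rfl fun σ _ => ?_
  simp only [AlternatingMap.smul_apply, smul_eq_mul]; ring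

lemma wedge_zero {E : Type*} [AddCommGroup E] [Module ℝ E] {a b : ℕ}
    (α : (Fin a → E) → ℂ) (v : Fin (a + b) → E) :
    wedgeEval a b α (fun u => (0 : AlternatingMap ℝ E ℂ (Fin b)) u) v = 0 := by
  simp [wedgeEval]

open Classical in
lemma pointwise {E : Type*} [AddCommGroup E] [Module ℝ E] {N m a b : ℕ} (hN : N = m + b)
    (hmN : m ≤ N)
    (B : Module.Basis (Fin N) ℝ E) (ω : AlternatingMap ℝ E ℂ (Fin (a + b))) (v : Fin (a + b) → E) :
    ω v = ∑ c : Fin a → Fin m, wedgeEval a b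
      (fun u => Dform (fun i => B.coord (Fin.castLE hmN (c i))) u)
      (fun u => Gform hmN B B.coord ω c u) v := by
  unfold Gform
  simp_rw [wedge_sum]
  rw [Finset.sum_comm]
  conv_lhs => rw [expansion B ω]
  rw [alt_sum_apply]
  refine Finset.sum_congr rfl fun f _ => ?_
  split_ifs with hf
  · have hlt : ∀ i : Fin a, (f (Fin.castAdd b i) : ℕ) < m := by
      intro i
      by_contra! hge
      have hcard := Fintype.card_le_of_injective
        (fun j : Fin (b + 1) => (⟨(f ⟨i + j, by omega⟩ : ℕ) - m, by omega⟩ : Fin b)) (by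
          intro j k hjk
          have hj : f (Fin.castAdd b i) ≤ f ⟨i + j, by omega⟩ :=
            hf.monotone (by simp [Fin.le_def])
          have hk : f (Fin.castAdd b i) ≤ f ⟨i + k, by omega⟩ :=
            hf.monotone (by simp [Fin.le_def])
          rw [Fin.le_def] at hj hk
          simp only [Fin.mk.injEq] at hjk
          have : f ⟨i + j, by omega⟩ = f ⟨i + k, by omega⟩ := by
            apply Fin.ext; omega
          have := hf.injective this
          simp only [Fin.mk.injEq] at this
          apply Fin.ext; omega)
      simp at hcard
    rw [Finset.sum_eq_single (fun i => (⟨f (Fin.castAdd b i), hlt i⟩ : Fin m))]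
    · rw [if_pos ⟨hf, fun i => by ext; simp⟩, wedge_smul, AlternatingMap.smul_apply, smul_eq_mul,
        ← wedge_det]
      congr 1
    · intro c _ hc
      rw [if_neg, wedge_zero]
      rintro ⟨-, h⟩
      apply hc
      ext i
      simp [h]
    · simp
  · rw [Finset.sum_eq_zero]
    · rfl
    · intro c _
      rw [if_neg (fun h => hf h.1), wedge_zero]

lemma extend_li {V : Type*} [AddCommGroup V] [Module ℝ V] {m : ℕ} (L : Fin m → V)
    (hL : LinearIndependent ℝ L) (b : ℕ) (hV : m + b ≤ Module.finrank ℝ V) :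
    ∃ ℓ : Fin (m + b) → V, LinearIndependent ℝ ℓ ∧ ∀ k, ℓ (Fin.castAdd b k) = L k := by
  induction b with
  | zero => exact ⟨L, hL, fun k => rfl⟩
  | succ b ih =>
    obtain ⟨ℓ, h1, h2⟩ := ih (by omega)
    obtain ⟨x, hx⟩ := exists_linearIndependent_snoc_of_lt_finrank h1 (by omega)
    refine ⟨Fin.snoc (α := fun _ => V) ℓ x, hx, fun k => ?_⟩
    rw [← h2]
    exact Fin.snoc_castSucc (α := fun _ => V) x ℓ (Fin.castAdd b k)

lemma frame {E : Type*} [NormedAddCommGroup E] [NormedSpace ℝ E] [FiniteDimensional ℝ E]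
    {m b : ℕ} (hN : Module.finrank ℝ E = m + b) (U : Set E) (hU : IsOpen U)
    (ρ : Fin m → E → ℝ) (hρ : ∀ k, ContDiffOn ℝ (⊤ : ℕ∞) (ρ k) U) (ζ₀ : E) (h₀ : ζ₀ ∈ U)
    (hli : LinearIndependent ℝ (fun k => fderiv ℝ (ρ k) ζ₀)) :
    ∃ ε > (0 : ℝ), Metric.ball ζ₀ ε ⊆ U ∧
      ∃ (μ : Fin (m + b) → E → E →L[ℝ] ℝ) (e : Fin (m + b) → E → E),
        (∀ k, ContDiffOn ℝ (⊤ : ℕ∞) (μ k) (Metric.ball ζ₀ ε)) ∧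
        (∀ k, ContDiffOn ℝ (⊤ : ℕ∞) (e k) (Metric.ball ζ₀ ε)) ∧
        (∀ k ζ, μ (Fin.castAdd b k) ζ = fderiv ℝ (ρ k) ζ) ∧
        ∀ ζ ∈ Metric.ball ζ₀ ε, ∃ B : Module.Basis (Fin (m + b)) ℝ E,
          (∀ k, B k = e k ζ) ∧ ∀ k, B.coord k = (μ k ζ : E →ₗ[ℝ] ℝ) := by
  have : CompleteSpace E := FiniteDimensional.complete ℝ E
  have hdual : Module.finrank ℝ (E →L[ℝ] ℝ) = m + b := by
    rw [← hN, ← Subspace.dual_finrank_eq (K := ℝ) (V := E)]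
    exact (LinearMap.toContinuousLinearMap (𝕜 := ℝ) (E := E) (F' := ℝ)).finrank_eq.symm
  obtain ⟨ℓ, hℓ, hℓ2⟩ := extend_li _ hli b hdual.ge
  let μ : Fin (m + b) → E → E →L[ℝ] ℝ := Fin.addCases (fun k ζ => fderiv ℝ (ρ k) ζ)
    (fun j _ => ℓ (Fin.natAdd m j))
  have hμl : ∀ k, μ (Fin.castAdd b k) = fun ζ => fderiv ℝ (ρ k) ζ := fun k => by simp [μ]
  have hμr : ∀ j, μ (Fin.natAdd m j) = fun ζ => ℓ (Fin.natAdd m j) := fun k => by simp [μ]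
  have hμs : ∀ k, ContDiffOn ℝ (⊤ : ℕ∞) (μ k) U := by
    intro k
    refine Fin.addCases (fun k => ?_) (fun j => ?_) k
    · rw [hμl]
      exact (hρ k).fderiv_of_isOpen hU (by simp)
    · rw [hμr]; exact contDiffOn_const
  have hμ0 : ∀ k, μ k ζ₀ = ℓ k := by
    intro k
    refine Fin.addCases (fun k => ?_) (fun j => ?_) k
    · rw [hμl, hℓ2]
    · rw [hμr]
  let Λ : E → E →L[ℝ] (Fin (m + b) → ℝ) := fun ζ => ∑ k,
    (ContinuousLinearMap.toSpanSingleton ℝ (Pi.single k 1 : Fin (m + b) → ℝ)).comp (μ k ζ)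
  have hΛa : ∀ ζ v k, Λ ζ v k = μ k ζ v := by
    intro ζ v k
    simp [Λ, Finset.sum_apply, Pi.single_apply]
  have hΛs : ContDiffOn ℝ (⊤ : ℕ∞) Λ U := by
    refine ContDiffOn.sum fun k _ => ?_
    exact contDiffOn_const.clm_comp (hμs k)
  have hinj : Function.Injective (Λ ζ₀).toLinearMap := by
    rw [← LinearMap.ker_eq_bot, LinearMap.ker_eq_bot']
    intro v hv
    have hv' : ∀ k, ℓ k v = 0 := fun k => by
      rw [← hμ0, ← hΛa]; exact congrFun hv k
    have hspan : Submodule.span ℝ (Set.range ℓ) = ⊤ :=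
      hℓ.span_eq_top_of_card_eq_finrank' (by simp [hdual])
    have hall : ∀ φ : E →L[ℝ] ℝ, φ v = 0 := by
      intro φ
      have hφ : φ ∈ Submodule.span ℝ (Set.range ℓ) := hspan ▸ Submodule.mem_top
      induction hφ using Submodule.span_induction with
      | mem x hx => obtain ⟨k, rfl⟩ := hx; exact hv' k
      | zero => rfl
      | add x y _ _ hx hy => simp [hx, hy]
      | smul a x _ hx => simp [hx]
    rw [← Module.forall_dual_apply_eq_zero_iff ℝ]
    intro φ
    exact hall φ.toContinuousLinearMap
  let A : E ≃L[ℝ] (Fin (m + b) → ℝ) :=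
    ((Λ ζ₀).toLinearMap.linearEquivOfInjective hinj (by simp [hN])).toContinuousLinearEquiv
  have hA : (A : E →L[ℝ] (Fin (m + b) → ℝ)) = Λ ζ₀ := by ext; rfl
  have hcont : ContinuousAt Λ ζ₀ := (hΛs.continuousOn.continuousAt (hU.mem_nhds h₀))
  have hev : ∀ᶠ ζ in nhds ζ₀, ζ ∈ U ∧ ∃ A' : E ≃L[ℝ] (Fin (m + b) → ℝ),
      (A' : E →L[ℝ] (Fin (m + b) → ℝ)) = Λ ζ := by
    refine Filter.Eventually.and (hU.mem_nhds h₀) ?_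
    have := hcont.eventually (p := fun T => T ∈ Set.range
      ((↑) : (E ≃L[ℝ] (Fin (m + b) → ℝ)) → E →L[ℝ] (Fin (m + b) → ℝ)))
      (by rw [← hA]; exact A.nhds)
    exact this
  obtain ⟨ε, hε, hball⟩ := Metric.eventually_nhds_iff_ball.1 hev
  refine ⟨ε, hε, fun ζ hζ => (hball ζ hζ).1, μ,
    fun k ζ => (Λ ζ).inverse (Pi.single k 1), fun k => (hμs k).mono fun ζ hζ => (hball ζ hζ).1,
    fun k => ?_, fun k ζ => by rw [hμl], fun ζ hζ => ?_⟩
  · refine ContDiffOn.clm_apply ?_ contDiffOn_const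
    intro ζ hζ
    obtain ⟨hζU, A', hA'⟩ := hball ζ hζ
    have h1 : ContDiffAt ℝ (⊤ : ℕ∞) ContinuousLinearMap.inverse (Λ ζ) := by
      rw [← hA']; exact contDiffAt_map_inverse A'
    exact (h1.comp ζ (hΛs.contDiffAt (hU.mem_nhds hζU))).contDiffWithinAt
  · obtain ⟨hζU, A', hA'⟩ := hball ζ hζ
    refine ⟨Module.Basis.ofEquivFun A'.toLinearEquiv, fun k => ?_, fun k => ?_⟩
    · show _ = (Λ ζ).inverse (Pi.single k 1)
      rw [← hA', ContinuousLinearMap.inverse_equiv, Module.Basis.coe_ofEquivFun]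
      rfl
    · ext v
      have := hΛa ζ v k
      rw [← hA'] at this
      simpa using this

lemma alt_contDiff {E : Type*} [NormedAddCommGroup E] [NormedSpace ℝ E] [FiniteDimensional ℝ E]
    {q : ℕ} (ω : AlternatingMap ℝ E ℂ (Fin q)) (e : Fin q → E → E) (S : Set E)
    (he : ∀ i, ContDiffOn ℝ (⊤ : ℕ∞) (e i) S) :
    ContDiffOn ℝ (⊤ : ℕ∞) (fun ζ => ω fun i => e i ζ) S := by
  have hc : Continuous ω.toMultilinearMap := by
    classical
    have hv : ∀ v, ω v = ∑ f : Fin q → Fin _, if StrictMono f then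
        (ω fun i => Module.finBasis ℝ E (f i)) *
          Dform (fun i => (Module.finBasis ℝ E).coord (f i)) v else 0 := by
      intro v
      conv_lhs => rw [expansion (Module.finBasis ℝ E) ω]
      rw [alt_sum_apply]
      refine Finset.sum_congr rfl fun f _ => ?_
      split_ifs <;> rfl
    have hv' : ⇑ω.toMultilinearMap = _ := funext hv
    rw [hv']
    refine continuous_finsetSum _ fun f _ => ?_
    split_ifs
    · simp only [Dform_apply]
      refine Continuous.mul continuous_const (Continuous.matrix_det ?_)
      refine continuous_matrix fun i j => ?_
      refine Complex.continuous_ofReal.comp ?_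
      exact (LinearMap.continuous_of_finiteDimensional _).comp (continuous_apply j)
    · exact continuous_const
  let W : ContinuousMultilinearMap ℝ (fun _ : Fin q => E) ℂ := ⟨ω.toMultilinearMap, hc⟩
  have hW : ContDiff ℝ (⊤ : ℕ∞) W := W.contDiff
  exact hW.comp_contDiffOn (contDiffOn_pi.2 he)

lemma Gform_contDiff {E : Type*} [NormedAddCommGroup E] [NormedSpace ℝ E] [FiniteDimensional ℝ E]
    {N m a b : ℕ} (hN : m ≤ N) (e : Fin N → E → E) (μ : Fin N → E → E →L[ℝ] ℝ)
    (ω : AlternatingMap ℝ E ℂ (Fin (a + b))) (S : Set E)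
    (he : ∀ i, ContDiffOn ℝ (⊤ : ℕ∞) (e i) S) (hμ : ∀ i, ContDiffOn ℝ (⊤ : ℕ∞) (μ i) S)
    (c : Fin a → Fin m) (u : Fin b → E) :
    ContDiffOn ℝ (⊤ : ℕ∞) (fun ζ => Gform hN (fun k => e k ζ)
      (fun k => (μ k ζ : E →ₗ[ℝ] ℝ)) ω c u) S := by
  classical
  unfold Gform
  simp only [alt_sum_apply]
  refine ContDiffOn.sum fun f _ => ?_
  split_ifs with hf
  · simp only [AlternatingMap.smul_apply, Dform_apply, smul_eq_mul, Matrix.det_apply']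
    refine (alt_contDiff ω (fun i => e (f i)) S fun i => he _).mul ?_
    refine ContDiffOn.sum fun σ _ => contDiffOn_const.mul ?_
    refine contDiffOn_prod fun i _ => ?_
    exact Complex.ofRealCLM.contDiff.comp_contDiffOn ((hμ _).clm_apply contDiffOn_const)
  · exact contDiffOn_const

lemma Gform_strict {E : Type*} [AddCommGroup E] [Module ℝ E] {N m a b : ℕ}
    (hN : m ≤ N) (e : Fin N → E) (μ : Fin N → E →ₗ[ℝ] ℝ) (ω : AlternatingMap ℝ E ℂ (Fin (a + b)))
    (c : Fin a → Fin m) (hc : ¬ StrictMono c) : Gform hN e μ ω c = 0 := by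
  unfold Gform
  refine Finset.sum_eq_zero fun f _ => if_neg ?_
  rintro ⟨hf, h⟩
  apply hc
  intro i j hij
  have := hf (show Fin.castAdd b i < Fin.castAdd b j from hij)
  rw [h, h] at this
  exact this

/-- the row map -/
noncomputable def rowMap {n π s : ℕ} (i : Fin π → Fin n) (κ : Fin s → Fin n) :
    EuclideanSpace ℂ (Fin n) →ₗ[ℝ] (Fin (π + s) → ℂ) where
  toFun x r := Fin.addCases (fun a : Fin π => (starRingEnd ℂ) (x (i a)))
              (fun b : Fin s => x (κ b)) r
  map_add' x y := by
    ext r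
    refine Fin.addCases (fun a => ?_) (fun b => ?_) r <;> simp
  map_smul' t x := by
    ext r
    refine Fin.addCases (fun a => ?_) (fun b => ?_) r <;> simp

/-- the left-hand form -/
noncomputable def omegaForm {n π s : ℕ} (i : Fin π → Fin n) (κ : Fin s → Fin n) :
    AlternatingMap ℝ (EuclideanSpace ℂ (Fin n)) ℂ (Fin (π + s)) :=
  AlternatingMap.compLinearMap
    { (Matrix.detRowAlternating (n := Fin (π + s)) (R := ℂ)).toMultilinearMap.restrictScalars ℝ with
      map_eq_zero_of_eq' := fun v j k h hjk =>
        (Matrix.detRowAlternating (n := Fin (π + s)) (R := ℂ)).map_eq_zero_of_eq v h hjk }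
    (rowMap i κ)

lemma omegaForm_apply {n π s : ℕ} (i : Fin π → Fin n) (κ : Fin s → Fin n)
    (v : Fin (π + s) → EuclideanSpace ℂ (Fin n)) :
    omegaForm i κ v = Matrix.det (Matrix.of fun r c' : Fin (π + s) =>
            Fin.addCases (fun a : Fin π => (starRingEnd ℂ) (v c' (i a)))
              (fun b : Fin s => v c' (κ b)) r) := by
  rw [← Matrix.det_transpose]
  rfl

lemma li_real {n m : ℕ} (L : Fin m → EuclideanSpace ℂ (Fin n) →L[ℝ] ℝ)
    (h : LinearIndependent ℂ (fun k : Fin m => (fun i : Fin n =>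
        (((L k (EuclideanSpace.single i 1) : ℝ) : ℂ) -
          Complex.I * ((L k (EuclideanSpace.single i Complex.I) : ℝ) : ℂ)) / 2))) :
    LinearIndependent ℝ L := by
  rw [Fintype.linearIndependent_iff] at h ⊢
  intro r hr k
  have := h (fun k => (r k : ℂ)) (by
    ext i
    have h1 : ∀ v, ∑ k, r k * L k v = 0 := fun v => by
      have := congrArg (fun T : EuclideanSpace ℂ (Fin n) →L[ℝ] ℝ => T v) hr
      simpa [ContinuousLinearMap.sum_apply] using this
    have e1 := congrArg (fun x : ℝ => (x : ℂ)) (h1 (EuclideanSpace.single i 1))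
    have e2 := congrArg (fun x : ℝ => (x : ℂ)) (h1 (EuclideanSpace.single i Complex.I))
    push_cast at e1 e2
    simp only [Finset.sum_apply, Pi.smul_apply, smul_eq_mul, Pi.zero_apply]
    calc _ = ((∑ k, (r k : ℂ) * (L k (EuclideanSpace.single i 1) : ℂ)) -
          Complex.I * ∑ k, (r k : ℂ) * (L k (EuclideanSpace.single i Complex.I) : ℂ)) / 2 := by
          rw [Finset.mul_sum, ← Finset.sum_sub_distrib, Finset.sum_div]
          refine Finset.sum_congr rfl fun k _ => ?_
          ring
      _ = 0 := by rw [e1, e2]; simp) k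
  exact_mod_cast this

/-- Lemma on tangential differentials: on a generic CR submanifold
`M = {ρ₁ = ⋯ = ρₘ = 0}` of the unit ball of `ℂⁿ`, for `n ≥ s > n-m` and `p > 2n-s-m`,
near each `ζ₀ ∈ M` the form `dζ̄_{i₁}∧⋯∧dζ̄_{iₚ}∧dζ_{k₁}∧⋯∧dζ_{kₛ}` can be written as
`∑ dρ_{j₁}∧⋯∧dρ_{jₜ}∧g^{i…}_{j…}` with `t = p-(2n-s-m)` and smooth forms `g`. -/
theorem tangential_differentials (n m : ℕ) (hm : 0 < m) (hmn : m < n)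
    (ρ : Fin m → EuclideanSpace ℂ (Fin n) → ℝ)
    (hρ : ∀ k, ContDiffOn ℝ (⊤ : ℕ∞) (ρ k) (Metric.ball 0 1))
    (hgeneric : ∀ ζ ∈ Metric.ball (0 : EuclideanSpace ℂ (Fin n)) 1, (∀ k, ρ k ζ = 0) →
      LinearIndependent ℂ (fun k : Fin m => (fun i : Fin n =>
        (((fderiv ℝ (ρ k) ζ (EuclideanSpace.single i 1) : ℝ) : ℂ) -
          Complex.I * ((fderiv ℝ (ρ k) ζ (EuclideanSpace.single i Complex.I) : ℝ) : ℂ)) / 2)))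
    (ζ₀ : EuclideanSpace ℂ (Fin n)) (hζ₀ : ζ₀ ∈ Metric.ball (0 : EuclideanSpace ℂ (Fin n)) 1)
    (hζ₀M : ∀ k, ρ k ζ₀ = 0) :
    ∃ ε > (0 : ℝ), Metric.ball ζ₀ ε ⊆ Metric.ball 0 1 ∧
      ∀ s π : ℕ, ∀ _hs₁ : s ≤ n, ∀ _hs₂ : n - m < s, ∀ _hp : 2 * n - s - m < π,
      ∀ i : Fin π → Fin n, StrictMono i → ∀ κ : Fin s → Fin n, StrictMono κ →
      ∃ g : (Fin (π - (2 * n - s - m)) → Fin m) → EuclideanSpace ℂ (Fin n) →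
          AlternatingMap ℝ (EuclideanSpace ℂ (Fin n)) ℂ
            (Fin (π + s - (π - (2 * n - s - m)))),
        (∀ c u, ContDiffOn ℝ (⊤ : ℕ∞) (fun ζ => g c ζ u) (Metric.ball ζ₀ ε)) ∧
        (∀ c, ¬ StrictMono c → g c = 0) ∧
        ∀ ζ ∈ Metric.ball ζ₀ ε, ∀ v : Fin (π + s) → EuclideanSpace ℂ (Fin n),
          Matrix.det (Matrix.of fun r c' : Fin (π + s) =>
            Fin.addCases (fun a : Fin π => (starRingEnd ℂ) (v c' (i a)))
              (fun b : Fin s => v c' (κ b)) r) =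
          ∑ c : Fin (π - (2 * n - s - m)) → Fin m,
            wedgeEval (π - (2 * n - s - m)) (π + s - (π - (2 * n - s - m)))
              (fun u => Matrix.det (Matrix.of fun a b : Fin (π - (2 * n - s - m)) =>
                ((fderiv ℝ (ρ (c a)) ζ (u b) : ℝ) : ℂ)))
              (fun u => g c ζ u)
              (fun a => v (Fin.cast (by omega) a)) := by
  have hfr : Module.finrank ℝ (EuclideanSpace ℂ (Fin n)) = m + (2 * n - m) := by
    rw [finrank_real_of_complex, finrank_euclideanSpace_fin]; omega
  obtain ⟨ε, hε, hsub, μ, e, hμ, he, hμρ, hB⟩ := frame hfr (Metric.ball 0 1) Metric.isOpen_ball ρ hρ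
    ζ₀ hζ₀ (li_real _ (hgeneric ζ₀ hζ₀ hζ₀M))
  refine ⟨ε, hε, hsub, ?_⟩
  intro s π hs₁ hs₂ hp i hi κ hκ
  have hq : π + s = (π - (2 * n - s - m)) + (π + s - (π - (2 * n - s - m))) := by omega
  have hb : 2 * n - m = π + s - (π - (2 * n - s - m)) := by omega
  have hmN : m ≤ m + (2 * n - m) := by omega
  let ω := (omegaForm i κ).domDomCongr (finCongr hq)
  refine ⟨fun c ζ => Gform hmN (fun k => e k ζ) (fun k => (μ k ζ).toLinearMap) ω c, ?_, ?_, ?_⟩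
  · intro c u
    exact Gform_contDiff hmN e μ ω _ he hμ c u
  · intro c hc
    funext ζ
    exact Gform_strict hmN _ _ ω c hc
  · intro ζ hζ v
    obtain ⟨B, hB1, hB2⟩ := hB ζ hζ
    have key := pointwise (by rw [hb]) hmN B ω (fun a => v (Fin.cast hq.symm a))
    have hL : ω (fun a => v (Fin.cast hq.symm a)) = omegaForm i κ v := rfl
    rw [← omegaForm_apply, ← hL, key]
    have h1 : (B : Fin (m + (2 * n - m)) → _) = fun k => e k ζ := funext hB1
    have h2 : B.coord = fun k => (μ k ζ).toLinearMap := funext hB2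
    rw [h1, h2]
    refine Finset.sum_congr rfl fun c _ => ?_
    congr 1
    funext u
    rw [Dform_apply]
    congr 1
    ext x y
    have : Fin.castLE hmN (c x) = Fin.castAdd _ (c x) := rfl
    simp only [Matrix.of_apply, this, hμρ]
    rfl
end

section
/- Let $\rho_1,\dots,\rho_m:\Omega\to\mathbb{R}$ be $C^1$ functions on an open set $\Omega\subseteq\mathbb{C}^n$, and let $z\in\Omega$ be such that the complex covectors $\partial\rho_1(z),\dots,\partial\rho_m(z)$ are $\mathbb{C}$-linearly independent. Define $F^{(k)}(\zeta,z)=-\sum_{i=1}^n\frac{\partial\rho_k}{\partial\zeta_i}(z)(\zeta_i-z_i)$. Then the $2m$ real differentials at $\zeta=z$ of the functions $\zeta\mapsto\rho_1(\zeta),\dots,\zeta\mapsto\rho_m(\zeta)$ and $\zeta\mapsto\operatorname{Im}F^{(1)}(\zeta,z),\dots,\zeta\mapsto\operatorname{Im}F^{(m)}(\zeta,z)$ are $\mathbb{R}$-linearly independent as $\mathbb{R}$-linear functionals on $\mathbb{C}^n\cong\mathbb{R}^{2n}$. In particular, the functions $\rho_k(\zeta)$, $\operatorname{Im}F^{(k)}(\zeta,z)$,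 $k=1,\dots,m$, can be completed to a local real $C^1$ coordinate system in $\zeta$ near $z$. -/
/-- The Wirtinger derivative `∂f/∂ζₐ = ½(∂f/∂xₐ - i ∂f/∂yₐ)` of a function on `ℂⁿ`. -/
noncomputable def wirt {n : ℕ} (a : Fin n) (f : (Fin n → ℂ) → ℂ) (z : Fin n → ℂ) : ℂ :=
  (fderiv ℝ f z (Pi.single a 1) - Complex.I * fderiv ℝ f z (Pi.single a Complex.I)) / 2

/-- If `ρ₁,…,ρₘ` are real-valued `C¹` functions near `z ∈ ℂⁿ` whose `(1,0)`-differentials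
`∂ρ₁(z),…,∂ρₘ(z)` are `ℂ`-linearly independent, and
`F⁽ᵏ⁾(ζ,z) = -∑ᵢ ∂ρₖ/∂ζᵢ(z)(ζᵢ - zᵢ)`, then the `2m` real differentials at `ζ = z` of
`ρ₁,…,ρₘ, Im F⁽¹⁾(·,z),…,Im F⁽ᵐ⁾(·,z)` are `ℝ`-linearly independent functionals. -/
theorem differentials_linearIndependent (n m : ℕ) (Ω : Set (Fin n → ℂ)) (hΩ : IsOpen Ω)
    (ρ : Fin m → (Fin n → ℂ) → ℝ) (hρ : ∀ k, ContDiffOn ℝ 1 (ρ k) Ω)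
    (z : Fin n → ℂ) (hz : z ∈ Ω)
    (hInd : LinearIndependent ℂ
      (fun k : Fin m => fun i : Fin n => wirt i (fun x => (ρ k x : ℂ)) z)) :
    LinearIndependent ℝ
      (Sum.elim
        (fun k : Fin m => fderiv ℝ (ρ k) z)
        (fun k : Fin m => fderiv ℝ
          (fun ζ : Fin n → ℂ =>
            (-(∑ i, wirt i (fun x => (ρ k x : ℂ)) z * (ζ i - z i))).im) z)) := by
  have hd : ∀ k, DifferentiableAt ℝ (ρ k) z := fun k =>
    ((hρ k).contDiffAt (hΩ.mem_nhds hz)).differentiableAt (by norm_num)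
  have hw : ∀ k i, wirt i (fun x => (ρ k x : ℂ)) z =
      ((fderiv ℝ (ρ k) z (Pi.single i 1) : ℂ)
        - Complex.I * (fderiv ℝ (ρ k) z (Pi.single i Complex.I) : ℂ)) / 2 := by
    intro k i
    have h1 : HasFDerivAt (fun x => (ρ k x : ℂ))
        (Complex.ofRealCLM.comp (fderiv ℝ (ρ k) z)) z :=
      Complex.ofRealCLM.hasFDerivAt.comp z (hd k).hasFDerivAt
    unfold wirt
    rw [h1.fderiv]
    simp
  generalize hW : (fun (k : Fin m) (i : Fin n) => wirt i (fun x => (ρ k x : ℂ)) z) = W at hInd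
  have hW' : ∀ k i, wirt i (fun x => (ρ k x : ℂ)) z = W k i := fun k i => by rw [← hW]
  simp only [hW'] at hw ⊢
  have hF : ∀ k v, fderiv ℝ (fun ζ : Fin n → ℂ => (-(∑ i, W k i * (ζ i - z i))).im) z v
      = -(∑ i, W k i * v i).im := by
    intro k v
    have h0 : ∀ i, HasFDerivAt (fun ζ : Fin n → ℂ => W k i * (ζ i - z i))
        (W k i • (ContinuousLinearMap.proj i : (Fin n → ℂ) →L[ℝ] ℂ)) z := fun i =>
      ((ContinuousLinearMap.proj (R := ℝ) (φ := fun _ : Fin n => ℂ) i).hasFDerivAt.sub_const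
        (z i)).const_mul (W k i)
    have h1 := Complex.imCLM.hasFDerivAt.comp z
      (HasFDerivAt.fun_sum (u := Finset.univ) fun i _ => h0 i).neg
    have h2 : HasFDerivAt (fun ζ : Fin n → ℂ => (-(∑ i, W k i * (ζ i - z i))).im) _ z := h1
    rw [h2.fderiv]
    simp
  rw [Fintype.linearIndependent_iff] at hInd ⊢
  intro g hg
  have key := hInd (fun k => (⟨2 * g (Sum.inl k), g (Sum.inr k)⟩ : ℂ)) (by
    funext i
    have e1 := congrArg (fun L => L (Pi.single i 1)) hg
    have e2 := congrArg (fun L => L (Pi.single i Complex.I)) hg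
    simp only [Fintype.sum_sum_type, Sum.elim_inl, Sum.elim_inr, add_apply,
      ContinuousLinearMap.sum_apply, ContinuousLinearMap.smul_apply, hF, smul_eq_mul,
      ContinuousLinearMap.zero_apply, Pi.single_apply, mul_ite, mul_zero,
      Finset.sum_ite_eq', Finset.mem_univ, if_true, ContinuousLinearMap.add_apply,
      ← Finset.sum_add_distrib] at e1 e2
    have r : ∀ k, fderiv ℝ (ρ k) z (Pi.single i 1) = 2 * (W k i).re := by
      intro k; rw [hw]; simp; ring
    have r' : ∀ k, fderiv ℝ (ρ k) z (Pi.single i Complex.I) = -2 * (W k i).im := by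
      intro k; rw [hw]; simp; ring
    simp only [Finset.sum_apply, Pi.smul_apply, smul_eq_mul, Pi.zero_apply]
    apply Complex.ext
    · rw [Complex.re_sum, Complex.zero_re, ← e1]
      refine Finset.sum_congr rfl fun k _ => ?_
      rw [r]; simp; ring
    · rw [Complex.im_sum, Complex.zero_im, ← neg_zero, ← e2, ← Finset.sum_neg_distrib]
      refine Finset.sum_congr rfl fun k _ => ?_
      rw [r']; simp; ring)
  rintro (k | k)
  · have := congrArg Complex.re (key k)
    simpa using this
  · have := congrArg Complex.im (key k)
    simpa using this
end
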